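/- For i ≠ j in {1, 2} and every integer n ≥ 0, the K-vector space Ext^n_A(S_i, S_j) has dimension 1 if n ≡ 1 or 2 (mod 4), and dimension 0 if n ≡ 0 or 3 (mod 4). -/

import Mathlib

/-!
Formalization of a statement from "On the Hochschild cohomology of tame Hecke algebras"
by K. Erdmann and S. Schroll.

`HA K` is the special biserial algebra `A = KQ/I` (the basic algebra of the Hecke algebra
`H_q(S_4)` at `q = -1`), presented by generators `e₁, e₂, ε, α, β` and the relations listed in
`HRel`.
-/

set_option synthInstance.maxHeartbeats 1000000
set_option maxHeartbeats 1000000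

open scoped TensorProduct

/-- The generators `e₁, e₂, ε, α, β` of the algebra `A`. -/
inductive HGen | e1 | e2 | eps | al | be

variable (K : Type) [Field K]

open FreeAlgebra in
/-- The defining relations of `A`:  `e₁² = e₁`, `e₂² = e₂`, `e₁e₂ = e₂e₁ = 0`, `e₁ + e₂ = 1`,
`e₁ε = εe₁ = ε`, `e₁α = α = αe₂`, `e₂β = β = βe₁`, `εα = 0`, `βε = 0`, `(αβ)² = ε²`. -/
inductive HRel : FreeAlgebra K HGen → FreeAlgebra K HGen → Prop
  | e1e1 : HRel (ι K HGen.e1 * ι K HGen.e1) (ι K HGen.e1)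
  | e2e2 : HRel (ι K HGen.e2 * ι K HGen.e2) (ι K HGen.e2)
  | e1e2 : HRel (ι K HGen.e1 * ι K HGen.e2) 0
  | e2e1 : HRel (ι K HGen.e2 * ι K HGen.e1) 0
  | sum  : HRel (ι K HGen.e1 + ι K HGen.e2) 1
  | e1eps : HRel (ι K HGen.e1 * ι K HGen.eps) (ι K HGen.eps)
  | epse1 : HRel (ι K HGen.eps * ι K HGen.e1) (ι K HGen.eps)
  | e1al : HRel (ι K HGen.e1 * ι K HGen.al) (ι K HGen.al)
  | ale2 : HRel (ι K HGen.al * ι K HGen.e2) (ι K HGen.al)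
  | e2be : HRel (ι K HGen.e2 * ι K HGen.be) (ι K HGen.be)
  | bee1 : HRel (ι K HGen.be * ι K HGen.e1) (ι K HGen.be)
  | epsal : HRel (ι K HGen.eps * ι K HGen.al) 0
  | beeps : HRel (ι K HGen.be * ι K HGen.eps) 0
  | abab : HRel (ι K HGen.al * ι K HGen.be * (ι K HGen.al * ι K HGen.be))
      (ι K HGen.eps * ι K HGen.eps)

/-- The algebra `A`. -/
abbrev HA := RingQuot (HRel K)

/-- The image of `e₁` in `A`. -/
def gE1 : HA K := RingQuot.mkAlgHom K (HRel K) (FreeAlgebra.ι K HGen.e1)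
/-- The image of `e₂` in `A`. -/
def gE2 : HA K := RingQuot.mkAlgHom K (HRel K) (FreeAlgebra.ι K HGen.e2)
/-- The image of `ε` in `A`. -/
def gEps : HA K := RingQuot.mkAlgHom K (HRel K) (FreeAlgebra.ι K HGen.eps)
/-- The image of `α` in `A`. -/
def gAl : HA K := RingQuot.mkAlgHom K (HRel K) (FreeAlgebra.ι K HGen.al)
/-- The image of `β` in `A`. -/
def gBe : HA K := RingQuot.mkAlgHom K (HRel K) (FreeAlgebra.ι K HGen.be)

/-- The algebra map `A →ₐ[K] K` defining the one-dimensional representation at vertex 1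
(`e₁` acts by `1`; `e₂, ε, α, β` act by `0`). -/
def phi1 : HA K →ₐ[K] K :=
  RingQuot.liftAlgHom K ⟨FreeAlgebra.lift K (fun g => match g with
    | HGen.e1 => (1 : K) | _ => 0), by
      rintro x y h
      induction h <;> simp⟩

/-- The algebra map `A →ₐ[K] K` defining the one-dimensional representation at vertex 2. -/
def phi2 : HA K →ₐ[K] K :=
  RingQuot.liftAlgHom K ⟨FreeAlgebra.lift K (fun g => match g with
    | HGen.e2 => (1 : K) | _ => 0), by
      rintro x y h
      induction h <;> simp⟩

/-- The simple right `A`-module `S_{i+1}` (one-dimensional, `e_{i+1}` acts as the identity,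
the other generators act by zero); `SMod K 0 = S₁` and `SMod K 1 = S₂`.
Right `A`-modules are modules over `Aᵐᵒᵖ`. -/
def SMod (_i : Fin 2) : Type := K

instance (i : Fin 2) : AddCommGroup (SMod K i) := inferInstanceAs (AddCommGroup K)

instance (i : Fin 2) : Module (HA K)ᵐᵒᵖ (SMod K i) :=
  Module.compHom K
    (((if i = 0 then phi1 K else phi2 K) : HA K →ₐ[K] K).toRingHom.fromOpposite
      (fun _ _ => mul_comm _ _))

open CategoryTheory in
/-- `dim_K Ext^n_A(S_{i+1}, S_{j+1})`, computed in the category of right `A`-modules,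
which is a `K`-linear abelian category with enough projectives. -/
noncomputable def extDim (i j : Fin 2) (n : ℕ) : ℕ :=
  Module.finrank K
    (((Ext K (ModuleCat (HA K)ᵐᵒᵖ) n).obj
      (Opposite.op (ModuleCat.of (HA K)ᵐᵒᵖ (SMod K i)))).obj
      (ModuleCat.of (HA K)ᵐᵒᵖ (SMod K j)))

open CategoryTheory
universe u v w
section cmp
variable {K : Type w} [Field K] {C : Type u} [Category.{w} C] [Abelian C] [Linear K C]
  [EnoughProjectives C] [HasExt.{w} C]

lemma smul_extMk {X : C} (P : ProjectiveResolution X) {Y : C} (n : ℕ) (r : K)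
    (f : P.complex.X (n+1) ⟶ Y) (hf : P.complex.d (n+2) (n+1) ≫ f = 0)
    (hf' : P.complex.d (n+2) (n+1) ≫ (r • f) = 0) :
    P.extMk (r • f) (n+2) rfl hf' = r • (P.extMk f (n+2) rfl hf) := by
  rw [Abelian.Ext.smul_eq_comp_mk₀, P.extMk_comp_mk₀]
  congr 1
  rw [Linear.comp_smul, Category.comp_id]

noncomputable def extMkLin {X : C} (P : ProjectiveResolution X) (Y : C) (n : ℕ) :
    LinearMap.ker (((P.complex.linearYonedaObj K Y).sc' n (n+1) (n+2)).g.hom) →ₗ[K]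
      Abelian.Ext.{w} X Y (n+1) where
  toFun f := P.extMk (n := n+1) (Y := Y) f.1 (n+2) rfl f.2
  map_add' f g := (P.add_extMk _ _ _ _ _ _).symm
  map_smul' r f := by
    exact smul_extMk P n r f.1 f.2 _

noncomputable def extIsoSucc (X Y : C) (n : ℕ) :
    (((Ext K C (n+1)).obj (Opposite.op X)).obj Y) ≃ₗ[K] Abelian.Ext.{w} X Y (n+1) := by
  let P := ProjectiveResolution.of X
  refine ((P.isoExt (R := K) (n+1) Y) ≪≫
    (P.complex.linearYonedaObj K Y).homologyIsoSc' n (n+1) (n+2) (by simp) (by simp) ≪≫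
    ShortComplex.moduleCatHomologyIso _).toLinearEquiv ≪≫ₗ ?_
  refine Submodule.quotEquivOfEq _ (LinearMap.ker (extMkLin P Y n)) ?_ ≪≫ₗ
    LinearMap.quotKerEquivOfSurjective (extMkLin P Y n) ?_
  · ext ⟨f, hf⟩
    rw [LinearMap.mem_ker]
    erw [P.extMk_eq_zero_iff (n := n+1) (Y := Y) f (n+2) rfl hf n rfl]
    constructor
    · rintro ⟨g, hg⟩
      exact ⟨g, congrArg Subtype.val hg⟩
    · rintro ⟨g, hg⟩
      exact ⟨g, Subtype.ext hg⟩
  · intro a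
    obtain ⟨f, hf, h⟩ := P.extMk_surjective a (n+2) rfl
    exact ⟨⟨f, hf⟩, h⟩

lemma ext_zero_subsingleton (X Y : C) (h : ∀ f : X ⟶ Y, f = 0) :
    Subsingleton (((Ext K C 0).obj (Opposite.op X)).obj Y) := by
  let P := ProjectiveResolution.of X
  suffices Limits.IsZero ((P.complex.linearYonedaObj K Y).homology 0) from
    ModuleCat.subsingleton_of_isZero (this.of_iso (P.isoExt (R := K) 0 Y))
  rw [← HomologicalComplex.exactAt_iff_isZero_homology,
    HomologicalComplex.exactAt_iff' _ 0 0 1 (by simp) (by simp), ShortComplex.moduleCat_exact_iff]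
  intro f hf
  refine ⟨0, ?_⟩
  rw [map_zero]
  change P.complex.X 0 ⟶ Y at f
  change P.complex.d 1 0 ≫ f = 0 at hf
  symm
  have e := P.exact₀
  have hd := e.g_desc f hf
  rw [← hd]
  have h2 : e.desc f hf = 0 := h (e.desc f hf)
  rw [h2, Limits.comp_zero]
  rfl

open Abelian in
lemma covShift {S : ShortComplex C} (hS : S.ShortExact) [Injective S.X₂] (X : C) (n : ℕ)
    (H : ∀ x : Ext.{w} X S.X₂ n, x.comp (Ext.mk₀ S.g) (add_zero n) = 0) :
    Module.finrank K (Ext.{w} X S.X₁ (n+1)) = Module.finrank K (Ext.{w} X S.X₃ n) := by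
  symm
  refine (LinearEquiv.ofBijective
    (Ext.postcompOfLinear hS.extClass K X (rfl : n + 1 = n + 1)) ⟨?_, ?_⟩).finrank_eq
  · rw [injective_iff_map_eq_zero]
    intro a ha
    obtain ⟨x, rfl⟩ := Ext.covariant_sequence_exact₃ X hS a rfl ha
    exact H x
  · intro b
    exact Ext.covariant_sequence_exact₁ X hS b (Ext.eq_zero_of_injective _) rfl

open Abelian in
lemma contraShift {S : ShortComplex C} (hS : S.ShortExact) [Projective S.X₂] (Y : C) (n : ℕ)
    (H : ∀ x : Ext.{w} S.X₂ Y n, (Ext.mk₀ S.f).comp x (zero_add n) = 0) :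
    Module.finrank K (Ext.{w} S.X₃ Y (n+1)) = Module.finrank K (Ext.{w} S.X₁ Y n) := by
  symm
  refine (LinearEquiv.ofBijective
    (Ext.precompOfLinear hS.extClass K Y (add_comm 1 n : 1 + n = n + 1)) ⟨?_, ?_⟩).finrank_eq
  · rw [injective_iff_map_eq_zero]
    intro a ha
    obtain ⟨x, rfl⟩ := Ext.contravariant_sequence_exact₁ hS Y a (add_comm 1 n) ha
    exact H x
  · intro b
    exact Ext.contravariant_sequence_exact₃ hS Y b (Ext.eq_zero_of_projective _) (add_comm 1 n)

open Abelian in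
lemma covShift_succ {S : ShortComplex C} (hS : S.ShortExact) [Injective S.X₂] (X : C) (n : ℕ) :
    Module.finrank K (Ext.{w} X S.X₁ (n+2)) = Module.finrank K (Ext.{w} X S.X₃ (n+1)) :=
  covShift hS X (n+1) fun x => by rw [Ext.eq_zero_of_injective x, Ext.zero_comp]

open Abelian in
lemma contraShift_succ {S : ShortComplex C} (hS : S.ShortExact) [Projective S.X₂] (Y : C)
    (n : ℕ) :
    Module.finrank K (Ext.{w} S.X₃ Y (n+2)) = Module.finrank K (Ext.{w} S.X₁ Y (n+1)) :=
  contraShift hS Y (n+1) fun x => by rw [Ext.eq_zero_of_projective x, Ext.comp_zero]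

open Abelian in
lemma covShift_one {S : ShortComplex C} (hS : S.ShortExact) [Injective S.X₂] (X : C)
    (H : ∀ f : X ⟶ S.X₂, f ≫ S.g = 0) :
    Module.finrank K (Ext.{w} X S.X₁ 1) = Module.finrank K (X ⟶ S.X₃) := by
  rw [covShift (K := K) hS X 0]
  · exact (Ext.linearEquiv₀ (R := K)).finrank_eq
  · intro x
    obtain ⟨f, rfl⟩ := (Ext.mk₀_bijective X S.X₂).2 x
    rw [Ext.mk₀_comp_mk₀, H, Ext.mk₀_zero]

open Abelian in
lemma contraShift_one {S : ShortComplex C} (hS : S.ShortExact) [Projective S.X₂] (Y : C)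
    (H : ∀ f : S.X₂ ⟶ Y, S.f ≫ f = 0) :
    Module.finrank K (Ext.{w} S.X₃ Y 1) = Module.finrank K (S.X₁ ⟶ Y) := by
  rw [contraShift (K := K) hS Y 0]
  · exact (Ext.linearEquiv₀ (R := K)).finrank_eq
  · intro x
    obtain ⟨f, rfl⟩ := (Ext.mk₀_bijective S.X₂ Y).2 x
    rw [Ext.mk₀_comp_mk₀, H, Ext.mk₀_zero]

end cmp
open MulOpposite

/-- image of a generator -/
def gen (g : HGen) : HA K := RingQuot.mkAlgHom K (HRel K) (FreeAlgebra.ι K g)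

theorem HA_induction {P : HA K → Prop} (hK : ∀ r, P (algebraMap K _ r)) (hg : ∀ g, P (gen K g))
    (hm : ∀ a b, P a → P b → P (a * b)) (ha : ∀ a b, P a → P b → P (a + b)) (a : HA K) : P a := by
  obtain ⟨x, rfl⟩ := RingQuot.mkAlgHom_surjective K (HRel K) a
  induction x using FreeAlgebra.induction with
  | grade0 r => rw [AlgHom.commutes]; exact hK r
  | grade1 g => exact hg g
  | mul a b h1 h2 => rw [map_mul]; exact hm _ _ h1 h2
  | add a b h1 h2 => rw [map_add]; exact ha _ _ h1 h2

/-- Combinatorial description of a right module with a monomial basis. -/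
structure Dat (n : ℕ) where
  src : HGen → Fin n → Option (Fin n)
  e1e1 : ∀ k, (src .e1 k).bind (src .e1) = src .e1 k := by decide
  e2e2 : ∀ k, (src .e2 k).bind (src .e2) = src .e2 k := by decide
  e1e2 : ∀ k, (src .e2 k).bind (src .e1) = none := by decide
  e2e1 : ∀ k, (src .e1 k).bind (src .e2) = none := by decide
  sum : ∀ k, (src .e1 k = some k ∧ src .e2 k = none) ∨ (src .e1 k = none ∧ src .e2 k = some k) := by decide
  e1eps : ∀ k, (src .eps k).bind (src .e1) = src .eps k := by decide
  epse1 : ∀ k, (src .e1 k).bind (src .eps) = src .eps k := by decide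
  e1al : ∀ k, (src .al k).bind (src .e1) = src .al k := by decide
  ale2 : ∀ k, (src .e2 k).bind (src .al) = src .al k := by decide
  e2be : ∀ k, (src .be k).bind (src .e2) = src .be k := by decide
  bee1 : ∀ k, (src .e1 k).bind (src .be) = src .be k := by decide
  epsal : ∀ k, (src .al k).bind (src .eps) = none := by decide
  beeps : ∀ k, (src .eps k).bind (src .be) = none := by decide
  abab : ∀ k, (((src .be k).bind (src .al)).bind (src .be)).bind (src .al) =
    (src .eps k).bind (src .eps) := by decide

/-- pullback along a partial function -/
def pullL {m n : ℕ} (t : Fin m → Option (Fin n)) : (Fin n → K) →ₗ[K] (Fin m → K) where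
  toFun v k := (t k).elim 0 v
  map_add' v w := by ext k; cases h : t k <;> simp [h]
  map_smul' r w := by ext k; cases h : t k <;> simp [h]

theorem pullL_apply {m n : ℕ} (t : Fin m → Option (Fin n)) (v : Fin n → K) (k : Fin m) :
    pullL K t v k = (t k).elim 0 v := rfl

theorem pullL_pullL {m n l : ℕ} (t : Fin m → Option (Fin n)) (s : Fin l → Option (Fin m))
    (v : Fin n → K) :
    pullL K s (pullL K t v) = pullL K (fun k => (s k).bind t) v := by
  ext k
  simp only [pullL_apply]
  cases h : s k <;> simp [pullL_apply]

theorem pullL_none {m n : ℕ} (v : Fin n → K) :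
    pullL K (fun _ : Fin m => (none : Option (Fin n))) v = 0 := rfl

/-- the representation attached to a combinatorial datum -/
def Dat.rep {n : ℕ} (D : Dat n) : HA K →ₐ[K] (Module.End K (Fin n → K))ᵐᵒᵖ :=
  RingQuot.liftAlgHom K ⟨FreeAlgebra.lift K (fun g => op (pullL K (D.src g))), by
    have key : ∀ x y : (Module.End K (Fin n → K))ᵐᵒᵖ,
      (∀ v, x.unop v = y.unop v) → x = y := fun x y h => by
        apply unop_injective
        exact LinearMap.ext h
    rintro x y h
    apply key
    intro v
    induction h <;> simp only [map_mul, map_add, map_one, map_zero, FreeAlgebra.lift_ι_apply,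
      unop_mul, unop_op, Module.End.mul_apply, pullL_pullL, unop_zero, unop_add, unop_one,
      LinearMap.zero_apply, LinearMap.add_apply, Module.End.one_apply]
    case e1e1 => simp only [D.e1e1]
    case e2e2 => simp only [D.e2e2]
    case e1e2 => simp only [D.e1e2, pullL_none]
    case e2e1 => simp only [D.e2e1, pullL_none]
    case sum =>
      ext k
      rcases D.sum k with ⟨h, h'⟩ | ⟨h, h'⟩ <;> simp [pullL_apply, h, h']
    case e1eps => simp only [D.e1eps]
    case epse1 => simp only [D.epse1]
    case e1al => simp only [D.e1al]
    case ale2 => simp only [D.ale2]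
    case e2be => simp only [D.e2be]
    case bee1 => simp only [D.bee1]
    case epsal => simp only [D.epsal, pullL_none]
    case beeps => simp only [D.beeps, pullL_none]
    case abab =>
      congr 2
      ext1 k
      rw [← D.abab]
      cases D.src .be k <;> simp [Option.bind_assoc]⟩

/-- the module attached to a combinatorial datum -/
def RM {n : ℕ} (_D : Dat n) : Type := Fin n → K

instance {n : ℕ} (D : Dat n) : AddCommGroup (RM K D) := inferInstanceAs (AddCommGroup (Fin n → K))
instance {n : ℕ} (D : Dat n) : Module K (RM K D) := inferInstanceAs (Module K (Fin n → K))

instance {n : ℕ} (D : Dat n) : Module (HA K)ᵐᵒᵖ (RM K D) :=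
  Module.compHom (R := Module.End K (Fin n → K)) (Fin n → K)
    (AlgHom.opComm (D.rep K)).toRingHom

/-- coordinates -/
def co {n : ℕ} {D : Dat n} (v : RM K D) : Fin n → K := v
/-- vector from coordinates -/
def toRM {n : ℕ} (D : Dat n) (v : Fin n → K) : RM K D := v

@[simp] theorem co_toRM {n : ℕ} (D : Dat n) (v : Fin n → K) : co K (toRM K D v) = v := rfl
@[simp] theorem toRM_co {n : ℕ} (D : Dat n) (v : RM K D) : toRM K D (co K v) = v := rfl
@[simp] theorem co_add {n : ℕ} {D : Dat n} (u v : RM K D) : co K (u + v) = co K u + co K v := rfl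
@[simp] theorem co_zero {n : ℕ} {D : Dat n} : co K (0 : RM K D) = 0 := rfl
@[simp] theorem co_smul {n : ℕ} {D : Dat n} (r : K) (v : RM K D) : co K (r • v) = r • co K v := rfl
theorem co_inj {n : ℕ} {D : Dat n} {u v : RM K D} (h : ∀ k, co K u k = co K v k) : u = v := funext h

theorem gen_smul {n : ℕ} (D : Dat n) (g : HGen) (v : RM K D) :
    op (gen K g) • v = toRM K D (pullL K (D.src g) (co K v)) := by
  change (D.rep K (gen K g)).unop v = _
  simp [Dat.rep, gen]
  rfl

theorem co_gen_smul {n : ℕ} (D : Dat n) (g : HGen) (v : RM K D) (k : Fin n) :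
    co K (op (gen K g) • v) k = (D.src g k).elim 0 (co K v) := by
  rw [gen_smul]; rfl

theorem alg_smul {n : ℕ} (D : Dat n) (r : K) (v : RM K D) :
    (algebraMap K (HA K)ᵐᵒᵖ r) • v = r • v := by
  change (D.rep K (algebraMap K (HA K) r)).unop v = _
  rw [AlgHom.commutes]
  rfl

/-- Constructor for linear maps. -/
def mkHom {M N : Type} [AddCommGroup M] [AddCommGroup N] [Module (HA K)ᵐᵒᵖ M]
    [Module (HA K)ᵐᵒᵖ N] (f : M →+ N)
    (h0 : ∀ (r : K) m, f (algebraMap K (HA K)ᵐᵒᵖ r • m) = algebraMap K (HA K)ᵐᵒᵖ r • f m)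
    (h1 : ∀ g m, f (op (gen K g) • m) = op (gen K g) • f m) : M →ₗ[(HA K)ᵐᵒᵖ] N where
  toFun := f
  map_add' := map_add f
  map_smul' a m := by
    rw [RingHom.id_apply, ← op_unop a]
    generalize a.unop = b
    induction b using HA_induction generalizing m with
    | hK r => exact h0 r m
    | hg g => exact h1 g m
    | hm a b ha hb => rw [MulOpposite.op_mul, mul_smul, hb, ha, ← mul_smul]
    | ha a b ha hb => rw [MulOpposite.op_add, add_smul, map_add, ha, hb, ← add_smul]

/-- Homs between combinatorial modules -/
def pullHom {m n : ℕ} (D : Dat n) (E : Dat m) (t : Fin m → Option (Fin n))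
    (h : ∀ g k, (t k).bind (D.src g) = (E.src g k).bind t) : RM K D →ₗ[(HA K)ᵐᵒᵖ] RM K E :=
  mkHom K (pullL K t).toAddMonoidHom
    (fun r v => by
      rw [alg_smul, alg_smul]; exact map_smul (pullL K t) r v)
    (fun g v => by
      rw [gen_smul, gen_smul]
      change pullL K t (pullL K (D.src g) (co K v)) = pullL K (E.src g) (pullL K t (co K v))
      simp only [pullL_pullL, h])

theorem pullHom_apply {m n : ℕ} (D : Dat n) (E : Dat m) (t : Fin m → Option (Fin n)) (h) (v)
    (k : Fin m) : co K (pullHom K D E t h v) k = (t k).elim 0 (co K v) := rfl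

instance : DecidableEq HGen := fun a b => by
  cases a <;> cases b <;> first | exact isTrue rfl | exact isFalse (by simp)
instance : Fintype HGen := ⟨{.e1,.e2,.eps,.al,.be}, by intro x; cases x <;> simp⟩

/-- structure table of `P1` -/
def P1src : HGen → Fin 6 → Option (Fin 6) := fun g => match g with
    | .e1 => ![some 0, some 1, none, some 3, none, some 5]
    | .e2 => ![none, none, some 2, none, some 4, none]
    | .eps => ![none, some 0, none, none, none, some 1]
    | .al => ![none, none, some 0, none, some 3, none]
    | .be => ![none, none, none, some 2, none, some 4]

/-- combinatorial datum of `P1` -/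
def P1D : Dat 6 where
  src := P1src

theorem P1D_src : P1D.src = P1src := rfl

/-- structure table of `P2` -/
def P2src : HGen → Fin 5 → Option (Fin 5) := fun g => match g with
    | .e1 => ![none, some 1, none, some 3, none]
    | .e2 => ![some 0, none, some 2, none, some 4]
    | .eps => ![none, none, none, none, none]
    | .al => ![none, none, some 1, none, some 3]
    | .be => ![none, some 0, none, some 2, none]

/-- combinatorial datum of `P2` -/
def P2D : Dat 5 where
  src := P2src

theorem P2D_src : P2D.src = P2src := rfl

/-- structure table of `U3` -/
def U3src : HGen → Fin 4 → Option (Fin 4) := fun g => match g with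
    | .e1 => ![none, some 1, none, some 3]
    | .e2 => ![some 0, none, some 2, none]
    | .eps => ![none, none, none, none]
    | .al => ![none, none, some 1, none]
    | .be => ![none, some 0, none, some 2]

/-- combinatorial datum of `U3` -/
def U3D : Dat 4 where
  src := U3src

theorem U3D_src : U3D.src = U3src := rfl

/-- structure table of `U2` -/
def U2src : HGen → Fin 2 → Option (Fin 2) := fun g => match g with
    | .e1 => ![some 0, some 1]
    | .e2 => ![none, none]
    | .eps => ![none, some 0]
    | .al => ![none, none]
    | .be => ![none, none]

/-- combinatorial datum of `U2` -/
def U2D : Dat 2 where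
  src := U2src

theorem U2D_src : U2D.src = U2src := rfl

/-- structure table of `U1` -/
def U1src : HGen → Fin 4 → Option (Fin 4) := fun g => match g with
    | .e1 => ![some 0, none, some 2, none]
    | .e2 => ![none, some 1, none, some 3]
    | .eps => ![none, none, none, none]
    | .al => ![none, some 0, none, some 2]
    | .be => ![none, none, some 1, none]

/-- combinatorial datum of `U1` -/
def U1D : Dat 4 where
  src := U1src

theorem U1D_src : U1D.src = U1src := rfl

/-- structure table of `S1` -/
def S1src : HGen → Fin 1 → Option (Fin 1) := fun g => match g with
    | .e1 => ![some 0]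
    | _ => ![none]

/-- combinatorial datum of `S1` -/
def S1D : Dat 1 where
  src := S1src

theorem S1D_src : S1D.src = S1src := rfl

/-- structure table of `S2` -/
def S2src : HGen → Fin 1 → Option (Fin 1) := fun g => match g with
    | .e2 => ![some 0]
    | _ => ![none]

/-- combinatorial datum of `S2` -/
def S2D : Dat 1 where
  src := S2src

theorem S2D_src : S2D.src = S2src := rfl

section table
theorem g_e1e1 : gen K .e1 * gen K .e1 = gen K .e1 := by
  simpa [gen] using RingQuot.mkAlgHom_rel K (HRel.e1e1 (K := K))
theorem g_e2e2 : gen K .e2 * gen K .e2 = gen K .e2 := by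
  simpa [gen] using RingQuot.mkAlgHom_rel K (HRel.e2e2 (K := K))
theorem g_e1e2 : gen K .e1 * gen K .e2 = 0 := by
  simpa [gen] using RingQuot.mkAlgHom_rel K (HRel.e1e2 (K := K))
theorem g_e2e1 : gen K .e2 * gen K .e1 = 0 := by
  simpa [gen] using RingQuot.mkAlgHom_rel K (HRel.e2e1 (K := K))
theorem g_e1eps : gen K .e1 * gen K .eps = gen K .eps := by
  simpa [gen] using RingQuot.mkAlgHom_rel K (HRel.e1eps (K := K))
theorem g_epse1 : gen K .eps * gen K .e1 = gen K .eps := by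
  simpa [gen] using RingQuot.mkAlgHom_rel K (HRel.epse1 (K := K))
theorem g_e1al : gen K .e1 * gen K .al = gen K .al := by
  simpa [gen] using RingQuot.mkAlgHom_rel K (HRel.e1al (K := K))
theorem g_ale2 : gen K .al * gen K .e2 = gen K .al := by
  simpa [gen] using RingQuot.mkAlgHom_rel K (HRel.ale2 (K := K))
theorem g_e2be : gen K .e2 * gen K .be = gen K .be := by
  simpa [gen] using RingQuot.mkAlgHom_rel K (HRel.e2be (K := K))
theorem g_bee1 : gen K .be * gen K .e1 = gen K .be := by
  simpa [gen] using RingQuot.mkAlgHom_rel K (HRel.bee1 (K := K))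
theorem g_epsal : gen K .eps * gen K .al = 0 := by
  simpa [gen] using RingQuot.mkAlgHom_rel K (HRel.epsal (K := K))
theorem g_beeps : gen K .be * gen K .eps = 0 := by
  simpa [gen] using RingQuot.mkAlgHom_rel K (HRel.beeps (K := K))
theorem g_abab : gen K .al * (gen K .be * (gen K .al * gen K .be)) = gen K .eps * gen K .eps := by
  simpa [gen, mul_assoc] using RingQuot.mkAlgHom_rel K (HRel.abab (K := K))
theorem g_epse2 : gen K .eps * gen K .e2 = 0 := by
  rw [← g_epse1, mul_assoc, g_e1e2, mul_zero]
theorem g_e2eps : gen K .e2 * gen K .eps = 0 := by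
  rw [← g_e1eps, ← mul_assoc, g_e2e1, zero_mul]
theorem g_ale1 : gen K .al * gen K .e1 = 0 := by
  rw [← g_ale2, mul_assoc, g_e2e1, mul_zero]
theorem g_e2al : gen K .e2 * gen K .al = 0 := by
  rw [← g_e1al, ← mul_assoc, g_e2e1, zero_mul]
theorem g_bee2 : gen K .be * gen K .e2 = 0 := by
  rw [← g_bee1, mul_assoc, g_e1e2, mul_zero]
theorem g_e1be : gen K .e1 * gen K .be = 0 := by
  rw [← g_e2be, ← mul_assoc, g_e1e2, zero_mul]
theorem g_alal : gen K .al * gen K .al = 0 := by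
  nth_rewrite 2 [← g_e1al]
  rw [← mul_assoc, g_ale1, zero_mul]
theorem g_bebe : gen K .be * gen K .be = 0 := by
  nth_rewrite 2 [← g_e2be]
  rw [← mul_assoc, g_bee2, zero_mul]
theorem g_aleps : gen K .al * gen K .eps = 0 := by
  rw [← g_e1eps, ← mul_assoc, g_ale1, zero_mul]
theorem g_epsbe : gen K .eps * gen K .be = 0 := by
  rw [← g_e2be, ← mul_assoc, g_epse2, zero_mul]
theorem g_eee : gen K .eps * (gen K .eps * gen K .eps) = 0 := by
  rw [← g_abab, ← mul_assoc, g_epsal, zero_mul]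
theorem g_babab : gen K .be * (gen K .al * (gen K .be * (gen K .al * gen K .be))) = 0 := by
  rw [g_abab, ← mul_assoc, g_beeps, zero_mul]
theorem g_ababa : gen K .al * (gen K .be * (gen K .al * (gen K .be * gen K .al))) = 0 := by
  have := congrArg (· * gen K .al) (g_abab K)
  simp only [mul_assoc] at this
  rw [this, g_epsal, mul_zero]
end table

/-- words for P1 -/
def w1 : Fin 6 → HA K := ![gen K .e1, gen K .eps, gen K .al, gen K .al * gen K .be,
  gen K .al * (gen K .be * gen K .al), gen K .eps * gen K .eps]
def w2 : Fin 5 → HA K := ![gen K .e2, gen K .be, gen K .be * gen K .al,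
  gen K .be * (gen K .al * gen K .be), gen K .be * (gen K .al * (gen K .be * gen K .al))]
/-- dual words -/
def d1 : Fin 6 → HA K := ![gen K .eps * gen K .eps, gen K .eps,
  gen K .be * (gen K .al * gen K .be), gen K .al * gen K .be, gen K .be, gen K .e1]
def d2 : Fin 5 → HA K := ![gen K .be * (gen K .al * (gen K .be * gen K .al)),
  gen K .al * (gen K .be * gen K .al), gen K .be * gen K .al, gen K .al, gen K .e2]


theorem gl_abab : gen K .al * gen K .be * gen K .al * gen K .be = gen K .eps * gen K .eps := by
  rw [← g_abab]; simp only [mul_assoc]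
theorem gl_eee : gen K .eps * gen K .eps * gen K .eps = 0 := by
  rw [← g_eee]; simp only [mul_assoc]
theorem gl_babab : gen K .be * gen K .al * gen K .be * gen K .al * gen K .be = 0 := by
  rw [← g_babab]; simp only [mul_assoc]

theorem gl_eea : gen K .eps * gen K .eps * gen K .al = 0 := by
  rw [mul_assoc, g_epsal, mul_zero]

theorem d1_mul (g : HGen) (k : Fin 6) : gen K g * d1 K k = ((P1D.src g) k).elim 0 (d1 K) := by
  cases g <;> fin_cases k <;> simp [P1D_src, P1src, d1, ← mul_assoc, g_e1e1, g_e2e1, g_e1eps,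
    g_epse1, g_e1al, g_e2be, g_bee1, g_epsal, g_beeps, gl_abab, g_e2eps, g_ale1, g_e2al,
    g_e1be, g_alal, g_bebe, g_aleps, g_epsbe, gl_eee, gl_babab]

theorem d2_mul (g : HGen) (k : Fin 5) : gen K g * d2 K k = ((P2D.src g) k).elim 0 (d2 K) := by
  cases g <;> fin_cases k <;> simp [P2D_src, P2src, d2, ← mul_assoc, g_e2e2, g_e1e2, g_e1al,
    g_ale2, g_e2be, g_epsal, gl_abab, gl_eea, g_epse2, g_e2al, g_bee2, g_e1be, g_alal, g_bebe,
    g_epsbe]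

theorem w1_mul (g : HGen) (v : Fin 6 → K) :
    ∑ k, (pullL K (P1D.src g) v) k • w1 K k = (∑ k, v k • w1 K k) * gen K g := by
  cases g <;> simp [P1D_src, P1src, w1, Fin.sum_univ_succ, pullL_apply, add_mul, mul_assoc, g_e1e1, g_e1e2,
    g_e1eps, g_epse1, g_e1al, g_ale2, g_bee1, g_epsal, g_beeps, g_abab, g_epse2, g_ale1,
    g_bee2, g_e1be, g_alal, g_bebe, g_aleps, g_epsbe, g_eee, g_ababa]

theorem w2_mul (g : HGen) (v : Fin 5 → K) :
    ∑ k, (pullL K (P2D.src g) v) k • w2 K k = (∑ k, v k • w2 K k) * gen K g := by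
  cases g <;> simp [P2D_src, P2src, w2, Fin.sum_univ_succ, pullL_apply, add_mul, mul_assoc, g_e2e2, g_e2e1,
    g_ale2, g_e2be, g_bee1, g_beeps, g_e2eps, g_ale1, g_e2al, g_bee2, g_alal, g_bebe, g_aleps,
    g_babab]

theorem opgen_mul_smul {n : ℕ} (D : Dat n) (g : HGen) (x : HA K) (v : RM K D) :
    op (gen K g * x) • v = op x • op (gen K g) • v := by
  rw [MulOpposite.op_mul, mul_smul]

theorem proj_of {n : ℕ} (D : Dat n) (w : Fin n → HA K) (b : RM K D)
    (hw : ∀ g v, ∑ k, (pullL K (D.src g) v) k • w k = (∑ k, v k • w k) * gen K g)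
    (hb : ∀ (k : Fin n), co K (op (w k) • b) = Pi.single k 1) :
    CategoryTheory.Projective (ModuleCat.of (HA K)ᵐᵒᵖ (RM K D)) := by
  rw [← IsProjective.iff_projective]
  let i : RM K D →ₗ[(HA K)ᵐᵒᵖ] (HA K)ᵐᵒᵖ := mkHom K
    { toFun := fun v => op (∑ k, v k • w k)
      map_zero' := by
        change op (∑ k, (0 : K) • w k) = 0
        simp
      map_add' := fun u v => by
        change op (∑ k, (u k + v k) • w k) = _
        simp [add_smul, Finset.sum_add_distrib] }
    (fun r v => by
      rw [alg_smul]
      change op (∑ k, (r * v k) • w k) = algebraMap K (HA K)ᵐᵒᵖ r * op (∑ k, v k • w k)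
      rw [← Algebra.smul_def, ← op_smul, Finset.smul_sum]
      simp only [smul_smul])
    (fun g v => by
      rw [gen_smul]
      exact congrArg op (hw g v))
  refine Module.Projective.of_split i (LinearMap.toSpanSingleton _ _ b) ?_
  ext v
  change op (∑ k, v k • w k) • b = v
  have : op (∑ k, co K v k • w k) = ∑ k, algebraMap K (HA K)ᵐᵒᵖ (co K v k) * op (w k) := by
    rw [Finset.op_sum]
    refine Finset.sum_congr rfl fun k _ => ?_
    rw [← Algebra.smul_def, op_smul]
  refine (congrArg (· • b) this).trans ?_
  rw [Finset.sum_smul]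
  have h2 : ∀ k, (algebraMap K (HA K)ᵐᵒᵖ (co K v k) * op (w k)) • b
    = (toRM K D (Pi.single k (co K v k))) := by
    intro k
    rw [mul_smul, alg_smul]
    change co K v k • co K (op (w k) • b) = _
    rw [hb, ← Pi.single_smul, smul_eq_mul, mul_one]
    rfl
  rw [Finset.sum_congr rfl fun k _ => h2 k]
  exact Finset.univ_sum_single (co K v)

theorem inj_of {n : ℕ} (D : Dat n) (d : Fin n → HA K) (l : Fin n)
    (hd : ∀ g k, gen K g * d k = (D.src g k).elim 0 d)
    (hl : ∀ (v : RM K D) (k : Fin n), co K (op (d k) • v) l = co K v k) :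
    CategoryTheory.Injective (ModuleCat.of (HA K)ᵐᵒᵖ (RM K D)) := by
  constructor
  intro X Y g f hf
  letI (M : ModuleCat (HA K)ᵐᵒᵖ) : Module K M := Module.compHom M (algebraMap K (HA K)ᵐᵒᵖ)
  have tower (M : ModuleCat (HA K)ᵐᵒᵖ) (r : K) (m : M) :
    algebraMap K (HA K)ᵐᵒᵖ r • m = r • m := rfl
  have hinj : Function.Injective f := (ModuleCat.mono_iff_injective f).1 hf
  let fK : X →ₗ[K] Y :=
    { toFun := f, map_add' := map_add f.hom, map_smul' := fun r x => map_smul f.hom _ x }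
  obtain ⟨h, hh⟩ := fK.exists_leftInverse_of_injective (LinearMap.ker_eq_bot.2 hinj)
  have hh' : ∀ x, h (f x) = x := fun x => LinearMap.congr_fun hh x
  let lam : X →ₗ[K] K :=
    { toFun := fun x => (g x : RM K D) l
      map_add' := fun x y => by rw [map_add]; rfl
      map_smul' := fun r x => by
        have : g (r • x) = algebraMap K (HA K)ᵐᵒᵖ r • g x := map_smul g.hom _ x
        rw [this]
        exact congrFun (alg_smul K D r (g x)) l }
  let mu : Y →ₗ[K] K := lam.comp h
  let F : Y →ₗ[(HA K)ᵐᵒᵖ] RM K D := mkHom K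
    { toFun := fun y => (fun k => mu (op (d k) • y) : Fin n → K)
      map_zero' := by
        funext k
        change mu (op (d k) • 0) = 0
        rw [smul_zero, map_zero]
      map_add' := fun x y => by
        funext k
        change mu (op (d k) • (x + y)) = mu (op (d k) • x) + mu (op (d k) • y)
        rw [smul_add, map_add] }
    (fun r y => by
      rw [alg_smul]
      funext k
      change mu (op (d k) • (algebraMap K (HA K)ᵐᵒᵖ r • y)) = r • mu (op (d k) • y)
      rw [← map_smul, ← tower, ← mul_smul, ← mul_smul]
      rw [Algebra.commutes])
    (fun g y => by
      rw [gen_smul]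
      funext k
      change mu (op (d k) • (op (gen K g) • y)) = (D.src g k).elim 0 (fun k => mu (op (d k) • y))
      rw [← mul_smul, ← MulOpposite.op_mul, hd]
      cases D.src g k <;> simp)
  refine ⟨ModuleCat.ofHom F, ?_⟩
  ext x
  funext k
  change lam (h (op (d k) • f x)) = (g x : RM K D) k
  have : op (d k) • f x = f (op (d k) • x) := (map_smul f.hom _ x).symm
  rw [this, hh']
  refine Eq.trans ?_ (hl (g x) k)
  exact congrFun (map_smul g.hom _ x) l

instance projP1 : CategoryTheory.Projective (ModuleCat.of (HA K)ᵐᵒᵖ (RM K P1D)) := by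
  refine proj_of K P1D (w1 K) (toRM K _ (Pi.single 0 1)) (w1_mul K) ?_
  intro k
  funext l
  fin_cases k <;> fin_cases l <;> simp [w1, mul_smul, co_gen_smul, P1D_src, P1src]

instance projP2 : CategoryTheory.Projective (ModuleCat.of (HA K)ᵐᵒᵖ (RM K P2D)) := by
  refine proj_of K P2D (w2 K) (toRM K _ (Pi.single 0 1)) (w2_mul K) ?_
  intro k
  funext l
  fin_cases k <;> fin_cases l <;> simp [w2, mul_smul, co_gen_smul, P2D_src, P2src]

instance injP1 : CategoryTheory.Injective (ModuleCat.of (HA K)ᵐᵒᵖ (RM K P1D)) := by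
  refine inj_of K P1D (d1 K) 5 (d1_mul K) ?_
  intro v k
  fin_cases k <;> simp [d1, mul_smul, co_gen_smul, P1D_src, P1src]

instance injP2 : CategoryTheory.Injective (ModuleCat.of (HA K)ᵐᵒᵖ (RM K P2D)) := by
  refine inj_of K P2D (d2 K) 4 (d2_mul K) ?_
  intro v k
  fin_cases k <;> simp [d2, mul_smul, co_gen_smul, P2D_src, P2src]

section homs
open CategoryTheory

/-- short hand -/
abbrev MC {n : ℕ} (D : Dat n) : ModuleCat (HA K)ᵐᵒᵖ := ModuleCat.of (HA K)ᵐᵒᵖ (RM K D)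

/-- the short complex attached to combinatorial maps -/
def SC {a b c : ℕ} (A : Dat a) (B : Dat b) (C : Dat c) (t : Fin b → Option (Fin a))
    (s : Fin c → Option (Fin b))
    (ht : ∀ g k, (t k).bind (A.src g) = (B.src g k).bind t)
    (hs : ∀ g k, (s k).bind (B.src g) = (C.src g k).bind s)
    (h0 : ∀ k, (s k).bind t = none) : ShortComplex (ModuleCat (HA K)ᵐᵒᵖ) :=
  ShortComplex.mk (X₁ := MC K A) (X₂ := MC K B) (X₃ := MC K C)
    (ModuleCat.ofHom (pullHom K A B t ht)) (ModuleCat.ofHom (pullHom K B C s hs)) (by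
      ext v
      refine co_inj K (D := C) fun k => ?_
      change co K (pullHom K B C s hs (pullHom K A B t ht v)) k = 0
      rw [pullHom_apply]
      have := h0 k
      cases h : s k with
      | none => rfl
      | some j =>
        rw [h, Option.bind_some] at this
        rw [Option.elim_some, pullHom_apply, this]; rfl)

theorem SC_exact {a b c : ℕ} (A : Dat a) (B : Dat b) (C : Dat c) (t : Fin b → Option (Fin a))
    (s : Fin c → Option (Fin b)) (ht hs h0)
    (h1 : ∀ i, ∃ k, t k = some i) (h2 : ∀ l, ∃ k, s l = some k)
    (h3 : ∀ k, t k = none → ∃ l, s l = some k)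
    (h4 : ∀ k k' i, t k = some i → t k' = some i → k = k')
    (h5 : ∀ l l' k, s l = some k → s l' = some k → l = l') :
    (SC K A B C t s ht hs h0).ShortExact := by
  choose u hu using h1
  choose w hw using h2
  refine ModuleCat.shortComplex_shortExact _ ?_ ?_ ?_
  · intro (y : RM K B)
    refine ⟨fun hy => ?_, ?_⟩
    swap
    · rintro ⟨x, rfl⟩
      exact ConcreteCategory.congr_hom (SC K A B C t s ht hs h0).zero x
    have hy' : ∀ l, co K y (w l) = 0 := fun l => by
      have : co K (pullHom K B C s hs y) l = 0 := congrFun (congrArg (co K (D := C)) hy) l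
      rw [pullHom_apply, hw l] at this
      exact this
    refine ⟨toRM K A fun i => co K y (u i), ?_⟩
    refine co_inj K (D := B) fun k => ?_
    change co K (pullHom K A B t ht _) k = _
    rw [pullHom_apply]
    cases h : t k with
    | none =>
      obtain ⟨l, hl⟩ := h3 k h
      have := hy' l
      rw [hw l, Option.some.injEq] at hl
      rw [hl] at this
      exact this.symm
    | some i =>
      have : u i = k := h4 _ _ i (hu i) h
      change co K y (u i) = _
      rw [this]
  · intro (x : RM K A) (y : RM K A) hxy
    refine co_inj K (D := A) fun i => ?_
    have : co K (pullHom K A B t ht x) (u i) = co K (pullHom K A B t ht y) (u i) :=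
      congrFun (congrArg (co K (D := B)) hxy) (u i)
    rw [pullHom_apply, pullHom_apply, hu i] at this
    exact this
  · intro (z : RM K C)
    classical
    refine ⟨toRM K B fun k => if h : ∃ l, s l = some k then co K z h.choose else 0, ?_⟩
    refine co_inj K (D := C) fun l => ?_
    change co K (pullHom K B C s hs _) l = _
    rw [pullHom_apply, hw l]
    have hx : ∃ l', s l' = some (w l) := ⟨l, hw l⟩
    change (if h : ∃ l', s l' = some (w l) then co K z h.choose else 0) = _
    rw [dif_pos hx, h5 _ _ _ hx.choose_spec (hw l)]

/-- application of a morphism -/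
def ap {n m : ℕ} {D : Dat n} {E : Dat m} (f : MC K D ⟶ MC K E) (v : RM K D) : RM K E := f.hom v

theorem hom_gen {n m : ℕ} {D : Dat n} {E : Dat m} (f : MC K D ⟶ MC K E) (g : HGen) (v : RM K D) :
    ap K f (op (gen K g) • v) = op (gen K g) • (ap K f v) := map_smul f.hom _ v

theorem hom_K {n m : ℕ} {D : Dat n} {E : Dat m} (f : MC K D ⟶ MC K E) (r : K) (v : RM K D) :
    ap K f (r • v) = r • (ap K f v) := by
  rw [← alg_smul, ← alg_smul]; exact map_smul f.hom _ v

theorem S1_gen_ne (g : HGen) (hg : g ≠ .e1) (v : RM K S1D) : op (gen K g) • v = 0 := by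
  refine co_inj K fun k => ?_
  rw [co_gen_smul, S1D_src]
  fin_cases k
  cases g <;> first | exact absurd rfl hg | rfl

theorem S1_gen_e1 (v : RM K S1D) : op (gen K .e1) • v = v := by
  refine co_inj K fun k => ?_
  rw [co_gen_smul, S1D_src]
  fin_cases k
  rfl

theorem from_dead {m : ℕ} {E : Dat m} (f : MC K S1D ⟶ MC K E) (i : Fin m)
    (h : (∃ g k, g ≠ .e1 ∧ E.src g k = some i) ∨ E.src .e1 i = none) (v : RM K S1D) :
    co K (ap K f v) i = 0 := by
  rcases h with ⟨g, k, hg, hk⟩ | h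
  · have := hom_gen K f g v
    rw [S1_gen_ne K g hg v] at this
    have := congrFun (congrArg (co K) this) k
    rw [co_gen_smul, hk] at this
    rw [Option.elim_some] at this
    rw [← this]
    exact congrFun (congrArg (co K) (map_zero f.hom)) k
  · have := hom_gen K f .e1 v
    rw [S1_gen_e1] at this
    rw [this, co_gen_smul, h]; rfl

/-- basis vector -/
def bv {n : ℕ} (D : Dat n) (i : Fin n) : RM K D := toRM K D (Pi.single i 1)

theorem to_dead {n : ℕ} {D : Dat n} (f : MC K D ⟶ MC K S1D) (i : Fin n)
    (h : (∃ g j, g ≠ .e1 ∧ ∀ k, D.src g k = some j ↔ k = i) ∨ (∀ k, D.src .e1 k ≠ some i)) :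
    (ap K f (bv K D i)) = 0 := by
  rcases h with ⟨g, j, hg, hk⟩ | h
  · have := hom_gen K f g (bv K D j)
    rw [S1_gen_ne K g hg] at this
    rw [← this]
    congr 1
    refine co_inj K fun k => ?_
    rw [co_gen_smul]
    simp only [bv, co_toRM]
    by_cases hki : k = i
    · rw [(hk k).2 hki, hki]; simp
    · rw [Pi.single_eq_of_ne hki]
      have : D.src g k ≠ some j := fun h => hki ((hk k).1 h)
      cases h' : D.src g k with
      | none => rfl
      | some a =>
        rw [Option.elim_some, Pi.single_eq_of_ne]
        rintro rfl; exact this h'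
  · have := hom_gen K f .e1 (bv K D i)
    rw [S1_gen_e1] at this
    rw [← this]
    have h0 : op (gen K .e1) • bv K D i = 0 := by
      refine co_inj K fun k => ?_
      rw [co_gen_smul]
      simp only [bv, co_toRM]
      cases h' : D.src .e1 k with
      | none => rfl
      | some a =>
        rw [Option.elim_some, Pi.single_eq_of_ne]; rfl
        rintro rfl; exact h k h'
    rw [h0]
    exact map_zero f.hom

theorem hom_sum {n m : ℕ} {D : Dat n} {E : Dat m} (f : MC K D ⟶ MC K E) (v : RM K D) :
    (ap K f v) = ∑ i, co K v i • (ap K f (bv K D i)) := by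
  have : v = ∑ i, co K v i • bv K D i := by
    have h (i) : co K v i • bv K D i = toRM K D (Pi.single i (co K v i)) := by
      change co K v i • (Pi.single i 1 : Fin n → K) = (Pi.single i (co K v i) : Fin n → K)
      rw [← Pi.single_smul, smul_eq_mul, mul_one]
    rw [Finset.sum_congr rfl fun i _ => h i]
    exact (Finset.univ_sum_single (co K v)).symm
  conv_lhs => rw [this]
  refine (map_sum f.hom _ _).trans ?_
  exact Finset.sum_congr rfl fun i _ => hom_K K f _ _

theorem from_zero {m : ℕ} (E : Dat m)
    (h : ∀ i, (∃ g k, g ≠ .e1 ∧ E.src g k = some i) ∨ E.src .e1 i = none)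
    (f : MC K S1D ⟶ MC K E) : f = 0 := by
  ext v
  exact co_inj K (D := E) fun k => from_dead K f k (h k) v

theorem to_zero {n : ℕ} (D : Dat n)
    (h : ∀ i, (∃ g j, g ≠ .e1 ∧ ∀ k, D.src g k = some j ↔ k = i) ∨ (∀ k, D.src .e1 k ≠ some i))
    (f : MC K D ⟶ MC K S1D) : f = 0 := by
  ext v
  refine (hom_sum K f v).trans ?_
  refine (Finset.sum_eq_zero fun i _ => ?_)
  rw [to_dead K f i (h i), smul_zero]

theorem co_hom_smul {n m : ℕ} {D : Dat n} {E : Dat m} (f : MC K D ⟶ MC K E) (r : K) (v : RM K D)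
    (k : Fin m) : co K (ap K (r • f) v) k = r * co K (ap K f v) k :=
  congrFun (congrArg (co K) (alg_smul K E r (ap K f v))) k

theorem from_one {m : ℕ} (E : Dat m) (l : Fin m)
    (h : ∀ i, i ≠ l → (∃ g k, g ≠ .e1 ∧ E.src g k = some i) ∨ E.src .e1 i = none)
    (ht : ∀ g k, ((if k = l then some 0 else none : Option (Fin 1))).bind (S1D.src g)
      = (E.src g k).bind (fun k => if k = l then some 0 else none)) :
    Module.finrank K (MC K S1D ⟶ MC K E) = 1 := by
  refine finrank_eq_one (ModuleCat.ofHom (pullHom K S1D E _ ht)) ?_ ?_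
  · intro h0
    have : co K (ap K (ModuleCat.ofHom (pullHom K S1D E _ ht) : MC K S1D ⟶ MC K E) (bv K S1D 0)) l
      = 0 := by
      rw [h0]; rfl
    change co K (pullHom K S1D E _ ht (bv K S1D 0)) l = 0 at this
    rw [pullHom_apply, if_pos rfl] at this
    simp [bv] at this
  · intro f
    refine ⟨co K (ap K f (bv K S1D 0)) l, ?_⟩
    ext v
    refine co_inj K (D := E) fun k => ?_
    refine (co_hom_smul K _ _ v _).trans ?_
    change _ * co K (pullHom K S1D E _ ht v) k = _
    change _ = co K (ap K f v) k
    rw [pullHom_apply]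
    by_cases hk : k = l
    · rw [if_pos hk, Option.elim_some, hk, hom_sum K f v, Fin.sum_univ_one]
      rw [co_smul, Pi.smul_apply, smul_eq_mul, mul_comm]
    · rw [if_neg hk, Option.elim_none, mul_zero, from_dead K f k (h k hk)]

theorem to_one {n : ℕ} (D : Dat n) (l : Fin n)
    (h : ∀ i, i ≠ l → (∃ g j, g ≠ .e1 ∧ ∀ k, D.src g k = some j ↔ k = i) ∨
      (∀ k, D.src .e1 k ≠ some i))
    (ht : ∀ g (k : Fin 1), (some l : Option (Fin n)).bind (D.src g)
      = (S1D.src g k).bind (fun _ => some l)) :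
    Module.finrank K (MC K D ⟶ MC K S1D) = 1 := by
  refine finrank_eq_one (ModuleCat.ofHom (pullHom K D S1D (fun _ => some l) ht)) ?_ ?_
  · intro h0
    have : co K (ap K (ModuleCat.ofHom (pullHom K D S1D _ ht) : MC K D ⟶ MC K S1D) (bv K D l)) 0
      = 0 := by
      rw [h0]; rfl
    change co K (pullHom K D S1D _ ht (bv K D l)) 0 = 0 at this
    rw [pullHom_apply] at this
    simp [bv] at this
  · intro f
    refine ⟨co K (ap K f (bv K D l)) 0, ?_⟩
    ext v
    refine co_inj K (D := S1D) fun k => ?_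
    have hk : k = 0 := Subsingleton.elim _ _
    subst hk
    refine (co_hom_smul K _ _ v _).trans ?_
    change _ * co K (pullHom K D S1D _ ht v) 0 = _
    change _ = co K (ap K f v) 0
    rw [pullHom_apply, Option.elim_some, hom_sum K f v, Finset.sum_eq_single l]
    · rw [co_smul, Pi.smul_apply, smul_eq_mul, mul_comm]
    · intro i _ hi
      rw [to_dead K f i (h i hi), smul_zero]
    · intro h; exact absurd (Finset.mem_univ _) h

/-- sequences -/
def T1 := SC K S2D P2D U3D ![none, none, none, none, some 0] ![some 0, some 1, some 2, some 3]
  (by decide) (by decide) (by decide)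
def T2 := SC K U3D P1D U2D ![none, none, some 0, some 1, some 2, some 3] ![some 0, some 1]
  (by decide) (by decide) (by decide)
def T3 := SC K U2D P1D U1D ![none, some 0, none, none, none, some 1] ![some 0, some 2, some 3, some 4]
  (by decide) (by decide) (by decide)
def T4 := SC K U1D P2D S2D ![none, some 0, some 1, some 2, some 3] ![some 0]
  (by decide) (by decide) (by decide)

theorem T1e : (T1 K).ShortExact := SC_exact _ _ _ _ _ _ _ _ _
  (by decide) (by decide) (by decide) (by decide) (by decide)
theorem T2e : (T2 K).ShortExact := SC_exact _ _ _ _ _ _ _ _ _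
  (by decide) (by decide) (by decide) (by decide) (by decide)
theorem T3e : (T3 K).ShortExact := SC_exact _ _ _ _ _ _ _ _ _
  (by decide) (by decide) (by decide) (by decide) (by decide)
theorem T4e : (T4 K).ShortExact := SC_exact _ _ _ _ _ _ _ _ _
  (by decide) (by decide) (by decide) (by decide) (by decide)

end homs

section final
open CategoryTheory

theorem e12_1 : Module.finrank K (Abelian.Ext.{0} (MC K S1D) (MC K S2D) 1) = 1 := by
  haveI : Injective (T1 K).X₂ := injP2 K
  refine (covShift_one (K := K) (T1e K) (MC K S1D) ?_).trans ?_
  · intro f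
    rw [from_zero K P2D (by decide) f]; exact Limits.zero_comp
  · exact from_one K U3D 3 (by decide) (by decide)

theorem e3_1 : Module.finrank K (Abelian.Ext.{0} (MC K S1D) (MC K U3D) 1) = 1 := by
  haveI : Injective (T2 K).X₂ := injP1 K
  refine (covShift_one (K := K) (T2e K) (MC K S1D) ?_).trans ?_
  · intro (f : MC K S1D ⟶ MC K P1D)
    ext v
    refine co_inj K (D := U2D) fun k => ?_
    fin_cases k
    · exact from_dead K f 0 (by decide) v
    · exact from_dead K f 1 (by decide) v
  · exact from_one K U2D 1 (by decide) (by decide)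

theorem e2_1 : Module.finrank K (Abelian.Ext.{0} (MC K S1D) (MC K U2D) 1) = 0 := by
  haveI : Injective (T3 K).X₂ := injP1 K
  refine (covShift_one (K := K) (T3e K) (MC K S1D) ?_).trans ?_
  · intro (f : MC K S1D ⟶ MC K P1D)
    ext v
    refine co_inj K (D := U1D) fun k => ?_
    fin_cases k
    · exact from_dead K f 0 (by decide) v
    · exact from_dead K f 2 (by decide) v
    · exact from_dead K f 3 (by decide) v
    · exact from_dead K f 4 (by decide) v
  · haveI : Subsingleton (MC K S1D ⟶ MC K U1D) :=
      subsingleton_of_forall_eq 0 (from_zero K U1D (by decide))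
    exact Module.finrank_zero_of_subsingleton (M := (MC K S1D ⟶ MC K U1D))

theorem e1_1 : Module.finrank K (Abelian.Ext.{0} (MC K S1D) (MC K U1D) 1) = 0 := by
  haveI : Injective (T4 K).X₂ := injP2 K
  refine (covShift_one (K := K) (T4e K) (MC K S1D) ?_).trans ?_
  · intro f
    rw [from_zero K P2D (by decide) f]; exact Limits.zero_comp
  · haveI : Subsingleton (MC K S1D ⟶ MC K S2D) :=
      subsingleton_of_forall_eq 0 (from_zero K S2D (by decide))
    exact Module.finrank_zero_of_subsingleton (M := (MC K S1D ⟶ MC K S2D))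

theorem sh1 (n : ℕ) : Module.finrank K (Abelian.Ext.{0} (MC K S1D) (MC K S2D) (n+2)) =
    Module.finrank K (Abelian.Ext.{0} (MC K S1D) (MC K U3D) (n+1)) := by
  haveI : Injective (T1 K).X₂ := injP2 K
  exact covShift_succ (K := K) (T1e K) (MC K S1D) n
theorem sh2 (n : ℕ) : Module.finrank K (Abelian.Ext.{0} (MC K S1D) (MC K U3D) (n+2)) =
    Module.finrank K (Abelian.Ext.{0} (MC K S1D) (MC K U2D) (n+1)) := by
  haveI : Injective (T2 K).X₂ := injP1 K
  exact covShift_succ (K := K) (T2e K) (MC K S1D) n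
theorem sh3 (n : ℕ) : Module.finrank K (Abelian.Ext.{0} (MC K S1D) (MC K U2D) (n+2)) =
    Module.finrank K (Abelian.Ext.{0} (MC K S1D) (MC K U1D) (n+1)) := by
  haveI : Injective (T3 K).X₂ := injP1 K
  exact covShift_succ (K := K) (T3e K) (MC K S1D) n
theorem sh4 (n : ℕ) : Module.finrank K (Abelian.Ext.{0} (MC K S1D) (MC K U1D) (n+2)) =
    Module.finrank K (Abelian.Ext.{0} (MC K S1D) (MC K S2D) (n+1)) := by
  haveI : Injective (T4 K).X₂ := injP2 K
  exact covShift_succ (K := K) (T4e K) (MC K S1D) n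

theorem f2_1 : Module.finrank K (Abelian.Ext.{0} (MC K S2D) (MC K S1D) 1) = 1 := by
  haveI : Projective (T4 K).X₂ := projP2 K
  refine (contraShift_one (K := K) (T4e K) (MC K S1D) ?_).trans ?_
  · intro f
    rw [to_zero K P2D (by decide) f]; exact Limits.comp_zero
  · exact to_one K U1D 0 (by decide) (by decide)

theorem res_P1 (f : MC K P1D ⟶ MC K S1D) (v : RM K P1D) (hv : co K v 0 = 0) : ap K f v = 0 := by
  rw [hom_sum K f v]
  refine Finset.sum_eq_zero fun i _ => ?_
  by_cases hi : i = 0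
  · rw [hi, hv, zero_smul]
  · have : ∀ i : Fin 6, i ≠ 0 → (∃ g j, g ≠ HGen.e1 ∧ ∀ k, P1D.src g k = some j ↔ k = i) ∨
      (∀ k, P1D.src .e1 k ≠ some i) := by decide
    rw [to_dead K f i (this i hi), smul_zero]

theorem fU1_1 : Module.finrank K (Abelian.Ext.{0} (MC K U1D) (MC K S1D) 1) = 1 := by
  haveI : Projective (T3 K).X₂ := projP1 K
  refine (contraShift_one (K := K) (T3e K) (MC K S1D) ?_).trans ?_
  · intro f
    ext v
    exact res_P1 K f _ rfl
  · exact to_one K U2D 0 (by decide) (by decide)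

theorem fU2_1 : Module.finrank K (Abelian.Ext.{0} (MC K U2D) (MC K S1D) 1) = 0 := by
  haveI : Projective (T2 K).X₂ := projP1 K
  refine (contraShift_one (K := K) (T2e K) (MC K S1D) ?_).trans ?_
  · intro f
    ext v
    exact res_P1 K f _ rfl
  · haveI : Subsingleton (MC K U3D ⟶ MC K S1D) :=
      subsingleton_of_forall_eq 0 (to_zero K U3D (by decide))
    exact Module.finrank_zero_of_subsingleton (M := (MC K U3D ⟶ MC K S1D))

theorem fU3_1 : Module.finrank K (Abelian.Ext.{0} (MC K U3D) (MC K S1D) 1) = 0 := by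
  haveI : Projective (T1 K).X₂ := projP2 K
  refine (contraShift_one (K := K) (T1e K) (MC K S1D) ?_).trans ?_
  · intro f
    rw [to_zero K P2D (by decide) f]; exact Limits.comp_zero
  · haveI : Subsingleton (MC K S2D ⟶ MC K S1D) :=
      subsingleton_of_forall_eq 0 (to_zero K S2D (by decide))
    exact Module.finrank_zero_of_subsingleton (M := (MC K S2D ⟶ MC K S1D))

theorem fh1 (n : ℕ) : Module.finrank K (Abelian.Ext.{0} (MC K S2D) (MC K S1D) (n+2)) =
    Module.finrank K (Abelian.Ext.{0} (MC K U1D) (MC K S1D) (n+1)) := by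
  haveI : Projective (T4 K).X₂ := projP2 K
  exact contraShift_succ (K := K) (T4e K) (MC K S1D) n
theorem fh2 (n : ℕ) : Module.finrank K (Abelian.Ext.{0} (MC K U1D) (MC K S1D) (n+2)) =
    Module.finrank K (Abelian.Ext.{0} (MC K U2D) (MC K S1D) (n+1)) := by
  haveI : Projective (T3 K).X₂ := projP1 K
  exact contraShift_succ (K := K) (T3e K) (MC K S1D) n
theorem fh3 (n : ℕ) : Module.finrank K (Abelian.Ext.{0} (MC K U2D) (MC K S1D) (n+2)) =
    Module.finrank K (Abelian.Ext.{0} (MC K U3D) (MC K S1D) (n+1)) := by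
  haveI : Projective (T2 K).X₂ := projP1 K
  exact contraShift_succ (K := K) (T2e K) (MC K S1D) n
theorem fh4 (n : ℕ) : Module.finrank K (Abelian.Ext.{0} (MC K U3D) (MC K S1D) (n+2)) =
    Module.finrank K (Abelian.Ext.{0} (MC K S2D) (MC K S1D) (n+1)) := by
  haveI : Projective (T1 K).X₂ := projP2 K
  exact contraShift_succ (K := K) (T1e K) (MC K S1D) n

/-- periodicity packaged -/
theorem period (d : ℕ → ℕ) (h0 : d 0 = 0) (h1 : d 1 = 1) (h2 : d 2 = 1) (h3 : d 3 = 0)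
    (h4 : d 4 = 0) (hp : ∀ n, d (n + 1 + 4) = d (n + 1)) (n : ℕ) :
    ((n % 4 = 1 ∨ n % 4 = 2) → d n = 1) ∧ ((n % 4 = 0 ∨ n % 4 = 3) → d n = 0) := by
  induction n using Nat.strong_induction_on with
  | _ n ih =>
    by_cases hn : n < 5
    · interval_cases n <;> simp [*]
    · obtain ⟨m, rfl⟩ : ∃ m, n = m + 1 + 4 := ⟨n - 5, by omega⟩
      rw [hp]
      have := ih (m + 1) (by omega)
      rwa [show (m + 1 + 4) % 4 = (m + 1) % 4 by omega]

theorem phi1_gen (g : HGen) : phi1 K (gen K g) = if g = .e1 then 1 else 0 := by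
  cases g <;> simp [phi1, gen]
theorem phi2_gen (g : HGen) : phi2 K (gen K g) = if g = .e2 then 1 else 0 := by
  cases g <;> simp [phi2, gen]

/-- underlying scalar -/
def sv {i : Fin 2} (v : SMod K i) : K := v

theorem sv0 (a : HA K) (v : SMod K 0) : sv K (op a • v) = phi1 K a * sv K v := rfl
theorem sv1 (a : HA K) (v : SMod K 1) : sv K (op a • v) = phi2 K a * sv K v := rfl

/-- comparison map -/
def cmpAdd (i : Fin 2) (D : Dat 1) : SMod K i →+ RM K D where
  toFun v := toRM K D (fun _ => sv K v)
  map_zero' := rfl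
  map_add' _ _ := rfl

theorem cmp_bij (i : Fin 2) (D : Dat 1) : Function.Bijective (cmpAdd K i D) := by
  constructor
  · intro x y h
    exact congrFun h 0
  · intro y
    refine ⟨(co K y 0 : K), ?_⟩
    refine co_inj K fun k => ?_
    fin_cases k; rfl

def cmp0 : SMod K 0 →ₗ[(HA K)ᵐᵒᵖ] RM K S1D := mkHom K (cmpAdd K 0 S1D)
  (fun r v => by
    rw [alg_smul]
    refine co_inj K fun k => ?_
    change sv K (op (algebraMap K (HA K) r) • v) = r * sv K v
    rw [sv0, AlgHom.commutes]; rfl)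
  (fun g v => by
    refine co_inj K fun k => ?_
    rw [co_gen_smul]
    change sv K (op (gen K g) • v) = _
    rw [sv0, phi1_gen]
    fin_cases k
    cases g <;> simp [S1D_src, S1src] <;> rfl)

def cmp1 : SMod K 1 →ₗ[(HA K)ᵐᵒᵖ] RM K S2D := mkHom K (cmpAdd K 1 S2D)
  (fun r v => by
    rw [alg_smul]
    refine co_inj K fun k => ?_
    change sv K (op (algebraMap K (HA K) r) • v) = r * sv K v
    rw [sv1, AlgHom.commutes]; rfl)
  (fun g v => by
    refine co_inj K fun k => ?_
    rw [co_gen_smul]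
    change sv K (op (gen K g) • v) = _
    rw [sv1, phi2_gen]
    fin_cases k
    cases g <;> simp [S2D_src, S2src] <;> rfl)

noncomputable def iso0 : ModuleCat.of (HA K)ᵐᵒᵖ (SMod K 0) ≅ MC K S1D :=
  (LinearEquiv.ofBijective (cmp0 K) (cmp_bij K 0 S1D)).toModuleIso
noncomputable def iso1 : ModuleCat.of (HA K)ᵐᵒᵖ (SMod K 1) ≅ MC K S2D :=
  (LinearEquiv.ofBijective (cmp1 K) (cmp_bij K 1 S2D)).toModuleIso

theorem ext_iso {X X' Y Y' : ModuleCat (HA K)ᵐᵒᵖ} (a : X ≅ X') (b : Y ≅ Y') (n : ℕ) :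
    Module.finrank K (((Ext K (ModuleCat (HA K)ᵐᵒᵖ) n).obj (Opposite.op X)).obj Y) =
    Module.finrank K (((Ext K (ModuleCat (HA K)ᵐᵒᵖ) n).obj (Opposite.op X')).obj Y') :=
  ((((Ext K (ModuleCat (HA K)ᵐᵒᵖ) n).mapIso a.op).symm.app Y) ≪≫
    ((Ext K (ModuleCat (HA K)ᵐᵒᵖ) n).obj (Opposite.op X')).mapIso b).toLinearEquiv.finrank_eq

theorem dim01 (n : ℕ) : extDim K 0 1 (n+1) =
    Module.finrank K (Abelian.Ext.{0} (MC K S1D) (MC K S2D) (n+1)) :=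
  (ext_iso K (iso0 K) (iso1 K) (n+1)).trans (extIsoSucc (K := K) _ _ n).finrank_eq
theorem dim10 (n : ℕ) : extDim K 1 0 (n+1) =
    Module.finrank K (Abelian.Ext.{0} (MC K S2D) (MC K S1D) (n+1)) :=
  (ext_iso K (iso1 K) (iso0 K) (n+1)).trans (extIsoSucc (K := K) _ _ n).finrank_eq

theorem dim01z : extDim K 0 1 0 = 0 := by
  refine (ext_iso K (iso0 K) (iso1 K) 0).trans ?_
  haveI := ext_zero_subsingleton (K := K) (MC K S1D) (MC K S2D) (from_zero K S2D (by decide))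
  exact Module.finrank_zero_of_subsingleton
theorem dim10z : extDim K 1 0 0 = 0 := by
  refine (ext_iso K (iso1 K) (iso0 K) 0).trans ?_
  haveI := ext_zero_subsingleton (K := K) (MC K S2D) (MC K S1D) (to_zero K S2D (by decide))
  exact Module.finrank_zero_of_subsingleton

end final

/-- For `i ≠ j` and every `n ≥ 0`, `dim_K Ext^n_A(S_i, S_j)` is `1` if `n ≡ 1, 2 (mod 4)`
and `0` if `n ≡ 0, 3 (mod 4)`. -/
theorem ext_s1_s2_dim (i j : Fin 2) (hij : i ≠ j) (n : ℕ) :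
    ((n % 4 = 1 ∨ n % 4 = 2) → extDim K i j n = 1) ∧
    ((n % 4 = 0 ∨ n % 4 = 3) → extDim K i j n = 0) := by
  fin_cases i <;> fin_cases j
  · exact absurd rfl hij
  · refine period (extDim K 0 1) (dim01z K) ?_ ?_ ?_ ?_ ?_ n
    · rw [dim01, e12_1]
    · rw [dim01, sh1, e3_1]
    · rw [dim01, sh1, sh2, e2_1]
    · rw [dim01, sh1, sh2, sh3, e1_1]
    · intro m
      rw [dim01 K m, dim01 K (m + 4), sh1 K (m + 3), sh2 K (m + 2), sh3 K (m + 1), sh4 K m]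
  · refine period (extDim K 1 0) (dim10z K) ?_ ?_ ?_ ?_ ?_ n
    · rw [dim10, f2_1]
    · rw [dim10, fh1, fU1_1]
    · rw [dim10, fh1, fh2, fU2_1]
    · rw [dim10, fh1, fh2, fh3, fU3_1]
    · intro m
      rw [dim10 K m, dim10 K (m + 4), fh1 K (m + 3), fh2 K (m + 2), fh3 K (m + 1), fh4 K m]
  · exact absurd rfl hij
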